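/- arXiv:1904.11199 — 5 statements merged into one kernel-verified Lean document; each statement's English description precedes it below -/
import Mathlib

section
/- Let m ≥ 1 and let A be a real m×m matrix whose off-diagonal entries are nonnegative and whose row sums are nonpositive, such that −A is invertible and (−A)⁻¹ has nonnegative entries. Let α be a probability row vector (α ≥ 0 entrywise, α·e = 1, where e is the all-ones column vector). Then: (a) c := α(−A)⁻¹e > 0; (b) x := (1/c)·α(−A)⁻¹ is a probability row vector; (c) xA = −(1/c)·α, so every entry of xA is nonpositive and xA ≠ 0; (d) x(A − (Ae)α) = 0, i.e., x is a stationary distribution vector of the last-column-linearly-augmented matrix Â := A − (Ae)α, which has all row sums equal to zero; and (e) if in addition every diagonal entry of A is strictly negative, then Σ_j |(xA)_j| / |A(j,j)| = (Σ_j α(j)/|A(j,j)|) / c, and this quantity is strictly positive. -/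
/-- The LBCL-augmented truncation approximation (equations (2.3)-(2.4)) together with
inequality (4.1) and the norm identity (4.2) of Theorem 4.1, specialized to a single
finite truncation `A` with augmentation distribution `α`. -/
theorem stmt2 {m : ℕ} (hm : 1 ≤ m) (A : Matrix (Fin m) (Fin m) ℝ)
    (hoff : ∀ i j, i ≠ j → 0 ≤ A i j)
    (hrow : ∀ i, ∑ j, A i j ≤ 0)
    (hunit : IsUnit (-A))
    (hinvnn : ∀ i j, 0 ≤ (-A)⁻¹ i j)
    (α : Fin m → ℝ) (hα0 : ∀ j, 0 ≤ α j) (hα1 : ∑ j, α j = 1)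
    (c : ℝ) (hc : c = ∑ j, Matrix.vecMul α (-A)⁻¹ j)
    (x : Fin m → ℝ) (hx : x = c⁻¹ • Matrix.vecMul α (-A)⁻¹) :
    0 < c ∧
    ((∀ j, 0 ≤ x j) ∧ ∑ j, x j = 1) ∧
    (Matrix.vecMul x A = -(c⁻¹ • α) ∧ (∀ j, Matrix.vecMul x A j ≤ 0) ∧
      Matrix.vecMul x A ≠ 0) ∧
    (Matrix.vecMul x (A - Matrix.of fun i j => (∑ k, A i k) * α j) = 0 ∧
      (∀ i, ∑ j, (A - Matrix.of fun i j => (∑ k, A i k) * α j) i j = 0)) ∧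
    ((∀ j, A j j < 0) →
      (∑ j, |Matrix.vecMul x A j| / |A j j|) = (∑ j, α j / |A j j|) / c ∧
        0 < (∑ j, α j / |A j j|) / c) := by
  have hdet : IsUnit (-A).det := (Matrix.isUnit_iff_isUnit_det _).mp hunit
  set y := Matrix.vecMul α (-A)⁻¹ with hy
  have hy0 : ∀ j, 0 ≤ y j := fun j => by
    rw [hy, Matrix.vecMul, dotProduct]
    exact Finset.sum_nonneg fun i _ => mul_nonneg (hα0 i) (hinvnn i j)
  have hyA : Matrix.vecMul y A = -α := by
    have h : Matrix.vecMul y (-A) = α := by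
      rw [hy, Matrix.vecMul_vecMul, Matrix.nonsing_inv_mul _ hdet, Matrix.vecMul_one]
    rw [Matrix.vecMul_neg] at h
    rw [← h, neg_neg]
  have hα_ne : α ≠ 0 := by
    rintro rfl
    simp at hα1
  have hc_pos : 0 < c := by
    refine lt_of_le_of_ne (hc ▸ Finset.sum_nonneg fun j _ => hy0 j) fun h0 => hα_ne ?_
    have hyz : y = 0 := by
      funext j
      exact (Finset.sum_eq_zero_iff_of_nonneg fun j _ => hy0 j).mp (hc.symm.trans h0.symm) j
        (Finset.mem_univ j)
    rw [hyz, Matrix.zero_vecMul] at hyA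
    exact neg_eq_zero.mp hyA.symm
  have hcinv : 0 < c⁻¹ := inv_pos.mpr hc_pos
  have hxA : Matrix.vecMul x A = -(c⁻¹ • α) := by
    rw [hx, Matrix.smul_vecMul, hyA, smul_neg]
  have hxAj : ∀ j, Matrix.vecMul x A j = -(c⁻¹ * α j) := fun j => by
    simp [hxA]
  have hxrow : ∑ i, x i * ∑ k, A i k = -c⁻¹ := by
    calc ∑ i, x i * ∑ k, A i k = ∑ k, Matrix.vecMul x A k := by
          simp only [Finset.mul_sum, Matrix.vecMul, dotProduct]
          exact Finset.sum_comm
      _ = -c⁻¹ := by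
          simp only [hxAj, Finset.sum_neg_distrib, ← Finset.mul_sum, hα1, mul_one]
  refine ⟨hc_pos, ⟨fun j => ?_, ?_⟩, ⟨hxA, fun j => ?_, ?_⟩, ⟨?_, fun i => ?_⟩,
    fun hdiag => ⟨?_, ?_⟩⟩
  · rw [hx]
    exact mul_nonneg hcinv.le (hy0 j)
  · simp only [hx, Pi.smul_apply, smul_eq_mul, ← Finset.mul_sum, ← hc]
    exact inv_mul_cancel₀ hc_pos.ne'
  · rw [hxAj]
    exact neg_nonpos.mpr (mul_nonneg hcinv.le (hα0 j))
  · rw [hxA]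
    exact neg_ne_zero.mpr (smul_ne_zero hcinv.ne' hα_ne)
  · funext j
    have h : Matrix.vecMul x (Matrix.of fun i j => (∑ k, A i k) * α j) j = -c⁻¹ * α j := by
      simp only [Matrix.vecMul, dotProduct, Matrix.of_apply, ← mul_assoc, ← Finset.sum_mul,
        hxrow]
    rw [Matrix.vecMul_sub, Pi.sub_apply, h, hxAj, Pi.zero_apply]
    ring
  · simp [Finset.sum_sub_distrib, ← Finset.mul_sum, hα1]
  · rw [Finset.sum_div]
    refine Finset.sum_congr rfl fun j _ => ?_
    rw [hxAj, abs_neg, abs_of_nonneg (mul_nonneg hcinv.le (hα0 j))]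
    ring
  · obtain ⟨j, hj⟩ := Function.ne_iff.mp hα_ne
    refine div_pos (Finset.sum_pos' (fun i _ => div_nonneg (hα0 i) (abs_nonneg _))
      ⟨j, Finset.mem_univ j, ?_⟩) hc_pos
    exact div_pos (lt_of_le_of_ne (hα0 j) (Ne.symm hj)) (abs_pos.mpr (hdiag j).ne)
end

section
/- Let S be a countable set and let Q = (q(i,j))_{i,j∈S} be an irreducible proper Q-matrix on S. Then Q has a subinvariant measure, i.e., there exists μ : S → ℝ with μ(i) ≥ 0 for all i, μ not identically zero, such that for every j ∈ S the family (μ(i)q(i,j))_{i≠j} is summable and Σ_{i≠j} μ(i)q(i,j) ≤ −μ(j)q(j,j). -/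
/-- A proper (stable and conservative) Q-matrix on a countable state space. -/
def IsProperQMatrix {S : Type*} (q : S → S → ℝ) : Prop :=
  (∀ i, q i i ≤ 0) ∧ (∀ i j, i ≠ j → 0 ≤ q i j) ∧
  (∀ i, Summable (fun j : {j : S // j ≠ i} => q i (j : S)) ∧
    (∑' j : {j : S // j ≠ i}, q i (j : S)) = -q i i)

/-- Irreducibility: any two distinct states are connected by a finite path of
positive transition rates. -/
def IsIrreducibleQ {S : Type*} (q : S → S → ℝ) : Prop :=
  ∀ i j : S, i ≠ j → ∃ m : ℕ, 1 ≤ m ∧ ∃ c : ℕ → S, c 0 = i ∧ c m = j ∧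
    ∀ r < m, 0 < q (c r) (c (r + 1))

/-- A subinvariant measure of a proper Q-matrix: nonnegative, not identically zero,
with `∑_{i ≠ j} μ i * q i j ≤ -(μ j * q j j)` for every `j`. -/
def IsSubinvariantMeasure {S : Type*} (q : S → S → ℝ) (μ : S → ℝ) : Prop :=
  (∀ i, 0 ≤ μ i) ∧ μ ≠ 0 ∧
  ∀ j, Summable (fun i : {i : S // i ≠ j} => μ (i : S) * q (i : S) j) ∧
    (∑' i : {i : S // i ≠ j}, μ (i : S) * q (i : S) j) ≤ -(μ j * q j j)

/-- An invariant measure of a proper Q-matrix: nonnegative, not identically zero,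
with `∑_{i ≠ j} μ i * q i j = -(μ j * q j j)` for every `j`. -/
def IsInvariantMeasure {S : Type*} (q : S → S → ℝ) (μ : S → ℝ) : Prop :=
  (∀ i, 0 ≤ μ i) ∧ μ ≠ 0 ∧
  ∀ j, Summable (fun i : {i : S // i ≠ j} => μ (i : S) * q (i : S) j) ∧
    (∑' i : {i : S // i ≠ j}, μ (i : S) * q (i : S) j) = -(μ j * q j j)

open scoped ENNReal

/-- `tabooVisits p o n j` is the probability that the chain started at `o` with transition
probabilities `p` is at `j` at time `n + 1` without having returned to `o` at times `1, …, n`. -/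
noncomputable def tabooVisits {S : Type*} (p : S → S → ℝ≥0∞) (o : S) : ℕ → S → ℝ≥0∞
  | 0 => p o
  | n + 1 => fun j => ∑' i : {i : S // i ≠ o}, tabooVisits p o n i * p i j

theorem ENNReal.tsum_eq_add_tsum_subtype_ne {S : Type*} (f : S → ℝ≥0∞) (o : S) :
    ∑' i, f i = f o + ∑' i : {i : S // i ≠ o}, f i := by
  rw [← ENNReal.summable.tsum_add_tsum_compl (s := {o}) ENNReal.summable, tsum_singleton o f]
  rfl

theorem sum_tabooVisits_self_add_tsum_le_one {S : Type*} {p : S → S → ℝ≥0∞}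
    (hp : ∀ i, ∑' j, p i j ≤ 1) (o : S) (n : ℕ) :
    ∑ k ∈ Finset.range n, tabooVisits p o k o + ∑' j, tabooVisits p o n j ≤ 1 := by
  induction n with
  | zero => simpa [tabooVisits] using hp o
  | succ n ih =>
    refine le_trans ?_ ih
    rw [Finset.sum_range_succ, add_assoc,
      ENNReal.tsum_eq_add_tsum_subtype_ne (tabooVisits p o n) o]
    gcongr
    calc ∑' j, tabooVisits p o (n + 1) j
        = ∑' i : {i : S // i ≠ o}, tabooVisits p o n i * ∑' j, p i j := by
          simp only [tabooVisits, ← ENNReal.tsum_mul_left]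
          exact ENNReal.tsum_comm
      _ ≤ ∑' i : {i : S // i ≠ o}, tabooVisits p o n i :=
          ENNReal.tsum_le_tsum fun i => mul_le_of_le_one_right' (hp i)

/-- A substochastic matrix has a subinvariant `ℝ≥0∞`-valued measure of mass one at a given
state. -/
theorem exists_subinvariant_of_substochastic {S : Type*} {p : S → S → ℝ≥0∞}
    (hp : ∀ i, ∑' j, p i j ≤ 1) (o : S) :
    ∃ ν : S → ℝ≥0∞, ν o = 1 ∧ ∀ j, ∑' i, ν i * p i j ≤ ν j := by
  classical
  refine ⟨fun j => if j = o then 1 else ∑' n, tabooVisits p o n j, if_pos rfl, fun j => ?_⟩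
  have key : ∑' i, (if i = o then 1 else ∑' n, tabooVisits p o n i) * p i j
      = ∑' n, tabooVisits p o n j := by
    rw [ENNReal.tsum_eq_add_tsum_subtype_ne _ o,
      tsum_eq_zero_add' (f := fun n => tabooVisits p o n j) ENNReal.summable]
    simp only [if_true, one_mul, tabooVisits]
    congr 1
    rw [ENNReal.tsum_comm]
    refine tsum_congr fun i => ?_
    rw [if_neg i.2, ENNReal.tsum_mul_right]
  refine key.trans_le ?_
  dsimp only
  split_ifs with h
  · subst h
    exact ENNReal.tsum_le_of_sum_range_le fun n =>
      le_self_add.trans (sum_tabooVisits_self_add_tsum_le_one hp j n)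
  · exact le_rfl

theorem IsProperQMatrix.le_neg_diag {S : Type*} {q : S → S → ℝ} (hq : IsProperQMatrix q)
    {i j : S} (hij : i ≠ j) : q i j ≤ -q i i := by
  rw [← (hq.2.2 i).2]
  exact (hq.2.2 i).1.le_tsum (⟨j, hij.symm⟩ : {j : S // j ≠ i}) fun k _ => hq.2.1 i k k.2.symm

theorem IsProperQMatrix.ne_of_pos {S : Type*} {q : S → S → ℝ} (hq : IsProperQMatrix q)
    {i j : S} (hij : 0 < q i j) : i ≠ j := by
  rintro rfl
  exact (hq.1 i).not_gt hij

theorem IsProperQMatrix.neg_diag_pos {S : Type*} [Nontrivial S] {q : S → S → ℝ}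
    (hq : IsProperQMatrix q) (hirr : IsIrreducibleQ q) (i : S) : 0 < -q i i := by
  obtain ⟨k, hk⟩ := exists_ne i
  obtain ⟨m, hm, c, rfl, -, hc⟩ := hirr i k hk.symm
  have h := hc 0 hm
  exact h.trans_le (hq.le_neg_diag (hq.ne_of_pos h))

/-- The transition matrix of the embedded jump chain. -/
noncomputable def jumpMatrix {S : Type*} (q : S → S → ℝ) (i : S) : S → ℝ≥0∞ :=
  {j | j ≠ i}.indicator fun j => ENNReal.ofReal (q i j / -q i i)

theorem jumpMatrix_of_ne {S : Type*} (q : S → S → ℝ) {i j : S} (h : i ≠ j) :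
    jumpMatrix q i j = ENNReal.ofReal (q i j / -q i i) :=
  Set.indicator_of_mem (s := {j | j ≠ i}) h.symm _

theorem IsProperQMatrix.tsum_jumpMatrix_le_one {S : Type*} {q : S → S → ℝ}
    (hq : IsProperQMatrix q) (i : S) : ∑' j, jumpMatrix q i j ≤ 1 := by
  unfold jumpMatrix
  rw [← tsum_subtype]
  change ∑' j : {j : S // j ≠ i}, ENNReal.ofReal (q i j / -q i i) ≤ 1
  rw [← ENNReal.ofReal_tsum_of_nonneg
    (fun j : {j : S // j ≠ i} => div_nonneg (hq.2.1 i j j.2.symm) (neg_nonneg.2 (hq.1 i)))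
    ((hq.2.2 i).1.div_const _), tsum_div_const, (hq.2.2 i).2]
  exact ENNReal.ofReal_le_one.2 (div_self_le_one _)

theorem IsIrreducibleQ.ne_top_of_subinvariant {S : Type*} [Nontrivial S] {q : S → S → ℝ}
    (hirr : IsIrreducibleQ q) (hq : IsProperQMatrix q) {ν : S → ℝ≥0∞} {o : S} (ho : ν o ≠ ∞)
    (hν : ∀ j, ∑' i, ν i * jumpMatrix q i j ≤ ν j) (i : S) : ν i ≠ ∞ := by
  by_cases hi : i = o
  · rwa [hi]
  obtain ⟨m, -, c, rfl, rfl, hc⟩ := hirr i o hi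
  refine Nat.decreasingInduction (motive := fun r _ => ν (c r) ≠ ∞) (fun r hr ih htop => ?_) ho
    m.zero_le
  have hle := (ENNReal.le_tsum (f := fun i => ν i * jumpMatrix q i (c (r + 1))) (c r)).trans
    (hν (c (r + 1)))
  rw [jumpMatrix_of_ne q (hq.ne_of_pos (hc r hr)), htop, ENNReal.top_mul] at hle
  · exact ih (top_le_iff.1 hle)
  · exact (ENNReal.ofReal_pos.2 (div_pos (hc r hr) (hq.neg_diag_pos hirr _))).ne'

/-- Proposition B.1 (i): an irreducible proper Q-matrix has a subinvariant measure. -/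
theorem stmt4 {S : Type*} [Countable S] [Nonempty S] (q : S → S → ℝ)
    (hq : IsProperQMatrix q) (hirr : IsIrreducibleQ q) :
    ∃ μ : S → ℝ, IsSubinvariantMeasure q μ := by
  rcases subsingleton_or_nontrivial S with hS | hS
  · refine ⟨1, fun _ => zero_le_one, one_ne_zero, fun j => ?_⟩
    have : IsEmpty {i : S // i ≠ j} := ⟨fun i => i.2 (Subsingleton.elim _ _)⟩
    exact ⟨summable_empty, by simpa using hq.1 j⟩
  obtain ⟨o⟩ := ‹Nonempty S›
  obtain ⟨ν, hνo, hν⟩ := exists_subinvariant_of_substochastic hq.tsum_jumpMatrix_le_one o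
  have hpos := hq.neg_diag_pos hirr
  have hfin := hirr.ne_top_of_subinvariant hq (hνo ▸ ENNReal.one_ne_top) hν
  refine ⟨fun i => (ν i).toReal / -q i i,
    fun i => div_nonneg ENNReal.toReal_nonneg (hpos i).le, fun h => ?_, fun j => ?_⟩
  · have h0 := congrFun h o
    simp only [hνo, ENNReal.toReal_one, Pi.zero_apply] at h0
    exact (one_div_pos.2 (hpos o)).ne' h0
  have hsum : ∑' i : {i : S // i ≠ j}, ν i * jumpMatrix q i j ≤ ν j :=
    (ENNReal.tsum_comp_le_tsum_of_injective Subtype.val_injective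
      fun i => ν i * jumpMatrix q i j).trans (hν j)
  have hsum_ne := ne_top_of_le_ne_top (hfin j) hsum
  have hterm : (fun i : {i : S // i ≠ j} => (ν i).toReal / -q i i * q i j)
      = fun i : {i : S // i ≠ j} => (ν i * jumpMatrix q i j).toReal := by
    funext i
    rw [jumpMatrix_of_ne q i.2, ENNReal.toReal_mul,
      ENNReal.toReal_ofReal (div_nonneg (hq.2.1 i j i.2) (hpos i).le)]
    ring
  rw [hterm]
  refine ⟨ENNReal.summable_toReal hsum_ne, ?_⟩
  rw [← ENNReal.tsum_toReal_eq fun i => ENNReal.ne_top_of_tsum_ne_top hsum_ne i,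
    ← mul_neg, div_mul_cancel₀ _ (hpos j).ne']
  exact ENNReal.toReal_mono (hfin j) hsum
end

section
/- Let S be a countable set, let Q = (q(i,j))_{i,j∈S} be a proper Q-matrix on S, and for each n ∈ ℕ let Q_n = (q_n(i,j)) be a proper Q-matrix on S having a stationary distribution vector π_n. Assume lim_{n→∞} q_n(i,j) = q(i,j) for all i, j ∈ S. Define μ : S → ℝ by μ(j) = liminf_{n→∞} π_n(j). Then Σ_{j∈S} μ(j) ≤ 1, and for every j ∈ S the family (μ(i)q(i,j))_{i≠j} is summable with Σ_{i≠j} μ(i)q(i,j) ≤ −μ(j)q(j,j); that is, μ is either identically zero or a subinvariant measure of Q of total mass at most 1. -/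
/-- A stationary distribution vector of a proper Q-matrix: a probability vector `π`
with `∑_{i ≠ j} π i * q i j = -(π j * q j j)` for every `j`. -/
def IsStationaryDistVec {S : Type*} (q : S → S → ℝ) (π : S → ℝ) : Prop :=
  (∀ j, 0 ≤ π j) ∧ Summable π ∧ (∑' j, π j) = 1 ∧
  ∀ j, Summable (fun i : {i : S // i ≠ j} => π (i : S) * q (i : S) j) ∧
    (∑' i : {i : S // i ≠ j}, π (i : S) * q (i : S) j) = -(π j * q j j)

open Filter

/-- Finite Fatou-type inequality for products of nonnegative sequences with convergent ones. -/
theorem sum_liminf_mul_le {ι : Type*} (F : Finset ι) {u c : ℕ → ι → ℝ} {v d : ℕ → ℝ}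
    {c' : ι → ℝ} {d' : ℝ} (hu0 : ∀ n i, 0 ≤ u n i)
    (hv1 : ∀ n, v n ≤ 1)
    (hc0 : ∀ n i, 0 ≤ c n i) (hd0 : ∀ n, 0 ≤ d n)
    (hc : ∀ i, Tendsto (fun n => c n i) atTop (nhds (c' i)))
    (hd : Tendsto d atTop (nhds d'))
    (h : ∀ n, ∑ i ∈ F, u n i * c n i ≤ v n * d n) :
    ∑ i ∈ F, liminf (fun n => u n i) atTop * c' i ≤ liminf v atTop * d' := by
  have key : ∀ ε > 0, ∑ i ∈ F, (liminf (fun n => u n i) atTop - ε) * c' i ≤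
      (liminf v atTop + ε) * d' := by
    intro ε hε
    have hlow : ∀ᶠ n in atTop, ∀ i ∈ F, liminf (fun n => u n i) atTop - ε < u n i := by
      rw [Finset.eventually_all]
      intro i _
      exact eventually_lt_of_lt_liminf (sub_lt_self _ hε)
        (isBoundedUnder_of ⟨0, fun n => hu0 n i⟩)
    have hup : ∃ᶠ n in atTop, v n < liminf v atTop + ε :=
      frequently_lt_of_liminf_lt
        (isBoundedUnder_of ⟨1, hv1⟩ : IsBoundedUnder (· ≤ ·) atTop v).isCoboundedUnder_ge
        (lt_add_of_pos_right _ hε)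
    have hlim : Tendsto (fun n => (liminf v atTop + ε) * d n -
        ∑ i ∈ F, (liminf (fun n => u n i) atTop - ε) * c n i) atTop
        (nhds ((liminf v atTop + ε) * d' -
          ∑ i ∈ F, (liminf (fun n => u n i) atTop - ε) * c' i)) :=
      (hd.const_mul _).sub (tendsto_finsetSum _ fun i _ => (hc i).const_mul _)
    refine sub_nonneg.1 (ge_of_tendsto_of_frequently hlim ?_)
    refine (hup.and_eventually hlow).mono fun n hn => sub_nonneg.2 ?_
    calc _ ≤ ∑ i ∈ F, u n i * c n i :=
          Finset.sum_le_sum fun i hi => mul_le_mul_of_nonneg_right (hn.2 i hi).le (hc0 n i)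
      _ ≤ v n * d n := h n
      _ ≤ _ := mul_le_mul_of_nonneg_right hn.1.le (hd0 n)
  have hl : Tendsto (fun ε : ℝ => ∑ i ∈ F, (liminf (fun n => u n i) atTop - ε) * c' i)
      (nhdsWithin 0 (Set.Ioi 0)) (nhds (∑ i ∈ F, liminf (fun n => u n i) atTop * c' i)) := by
    refine Tendsto.mono_left ?_ nhdsWithin_le_nhds
    exact Continuous.tendsto' (by fun_prop) _ _ (by simp)
  have hr : Tendsto (fun ε : ℝ => (liminf v atTop + ε) * d')
      (nhdsWithin 0 (Set.Ioi 0)) (nhds (liminf v atTop * d')) := by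
    refine Tendsto.mono_left ?_ nhdsWithin_le_nhds
    exact Continuous.tendsto' (by fun_prop) _ _ (by simp)
  exact le_of_tendsto_of_tendsto hl hr (eventually_nhdsWithin_of_forall key)

/-- The Fatou-type key step in the proof of Lemma B.2: the pointwise liminf `μ` of
stationary distribution vectors `π n` of proper Q-matrices `qn n` converging
entrywise to a proper Q-matrix `q` has total mass at most 1 and satisfies the
subinvariance inequalities for `q`. -/
theorem stmt9 {S : Type*} [Countable S] (q : S → S → ℝ)
    (hq : IsProperQMatrix q)
    (qn : ℕ → S → S → ℝ) (hqn : ∀ n, IsProperQMatrix (qn n))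
    (πn : ℕ → S → ℝ) (hπn : ∀ n, IsStationaryDistVec (qn n) (πn n))
    (hconv : ∀ i j, Tendsto (fun n => qn n i j) atTop (nhds (q i j)))
    (μ : S → ℝ) (hμ : μ = fun j => liminf (fun n => πn n j) atTop) :
    Summable μ ∧ (∑' j, μ j) ≤ 1 ∧
      ∀ j, Summable (fun i : {i : S // i ≠ j} => μ (i : S) * q (i : S) j) ∧
        (∑' i : {i : S // i ≠ j}, μ (i : S) * q (i : S) j) ≤ -(μ j * q j j) := by
  subst hμ
  have h0 : ∀ n i, 0 ≤ πn n i := fun n => (hπn n).1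
  have hsum : ∀ n (F : Finset S), ∑ i ∈ F, πn n i ≤ 1 := fun n F =>
    (hπn n).2.2.1 ▸ (hπn n).2.1.sum_le_tsum F fun i _ => h0 n i
  have h1 : ∀ n i, πn n i ≤ 1 := fun n i => by simpa using hsum n {i}
  have hμ0 : ∀ i, 0 ≤ liminf (fun n => πn n i) atTop := fun i =>
    le_liminf_of_le
      (isBoundedUnder_of ⟨1, fun n => h1 n i⟩ :
        IsBoundedUnder (· ≤ ·) atTop fun n => πn n i).isCoboundedUnder_ge
      (Eventually.of_forall fun n => h0 n i)
  have hmass : ∀ F : Finset S, ∑ i ∈ F, liminf (fun n => πn n i) atTop ≤ 1 := fun F => by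
    simpa using sum_liminf_mul_le F (u := πn) (c := fun _ _ => 1) (v := fun _ => 1)
      (d := fun _ => 1) h0 (fun _ => le_rfl)
      (fun _ _ => zero_le_one) (fun _ => zero_le_one) (fun _ => tendsto_const_nhds)
      tendsto_const_nhds (fun n => by simpa using hsum n F)
  refine ⟨summable_of_sum_le hμ0 hmass, Real.tsum_le_of_sum_le hμ0 hmass, fun j => ?_⟩
  have hnonneg : ∀ i : {i : S // i ≠ j},
      0 ≤ liminf (fun n => πn n (i : S)) atTop * q (i : S) j :=
    fun i => mul_nonneg (hμ0 i) (hq.2.1 i j i.2)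
  have hfin : ∀ F : Finset {i : S // i ≠ j},
      ∑ i ∈ F, liminf (fun n => πn n (i : S)) atTop * q (i : S) j ≤
        -(liminf (fun n => πn n j) atTop * q j j) := fun F => by
    rw [← mul_neg]
    refine sum_liminf_mul_le F (u := fun n i => πn n (i : S)) (c := fun n i => qn n (i : S) j)
      (v := fun n => πn n j) (d := fun n => -qn n j j) (fun n i => h0 n i)
      (fun n => h1 n j) (fun n i => (hqn n).2.1 i j i.2)
      (fun n => neg_nonneg.2 ((hqn n).1 j)) (fun i => hconv i j) (hconv j j).neg fun n => ?_
    obtain ⟨hs, he⟩ := (hπn n).2.2.2 j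
    rw [mul_neg, ← he]
    exact hs.sum_le_tsum F fun i _ => mul_nonneg (h0 n i) ((hqn n).2.1 i j i.2)
  exact ⟨summable_of_sum_le hnonneg hfin, Real.tsum_le_of_sum_le hnonneg hfin⟩
end

section
/- Let S be a countable set and let Q = (q(i,j))_{i,j∈S} be an irreducible proper Q-matrix on S that has a stationary distribution vector π with π(j) > 0 for all j, and assume that every subinvariant measure of Q is a positive scalar multiple of π. For each n ∈ ℕ let Q_n be a proper Q-matrix on S having a stationary distribution vector π_n, and assume lim_{n→∞} q_n(i,j) = q(i,j) for all i, j ∈ S. Fix j₀ ∈ S, let φ : ℕ → ℕ be strictly increasing, and let α ∈ ℝ be such that lim_{n→∞} π_{φ(n)}(j₀) = α. Then lim_{n→∞} π_{φ(n)}(j) = (α/π(j₀))·π(j) for every j ∈ S, and α ≤ π(j₀). -/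
open Filter

/-- Along an ultrafilter, a pointwise limit of stationary distribution vectors of proper
Q-matrices converging entrywise to `q` exists, has total mass at most one, and is either zero
or a subinvariant measure of `q`. -/
theorem exists_tendsto_of_isStationaryDistVec {ι S : Type*} (U : Ultrafilter ι)
    {q : S → S → ℝ} {qs : ι → S → S → ℝ} (hqs : ∀ n, IsProperQMatrix (qs n))
    {p : ι → S → ℝ} (hp : ∀ n, IsStationaryDistVec (qs n) (p n))
    (hconv : ∀ i j, Tendsto (fun n => qs n i j) U (nhds (q i j))) :
    ∃ μ : S → ℝ, (∀ j, Tendsto (fun n => p n j) U (nhds (μ j))) ∧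
      (∀ s : Finset S, ∑ i ∈ s, μ i ≤ 1) ∧ (μ ≠ 0 → IsSubinvariantMeasure q μ) := by
  have hle : ∀ n (s : Finset S), ∑ i ∈ s, p n i ≤ 1 := fun n s =>
    (hp n).2.2.1 ▸ (hp n).2.1.sum_le_tsum s fun i _ => (hp n).1 i
  have hlim : ∀ j, ∃ x, 0 ≤ x ∧ Tendsto (fun n => p n j) U (nhds x) := by
    intro j
    obtain ⟨x, hx, hUx⟩ := (isCompact_Icc (a := (0 : ℝ)) (b := 1)).ultrafilter_le_nhds
      (U.map fun n => p n j) (by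
        rw [le_principal_iff, Ultrafilter.coe_map]
        exact mem_map.2 (Eventually.of_forall fun n =>
          ⟨(hp n).1 j, by simpa using hle n {j}⟩))
    exact ⟨x, hx.1, hUx⟩
  choose μ hμ0 hμ using hlim
  refine ⟨μ, hμ, fun s => le_of_tendsto (tendsto_finsetSum s fun i _ => hμ i)
    (Eventually.of_forall fun n => hle n s), fun hne => ⟨hμ0, hne, fun j => ?_⟩⟩
  have hsum : ∀ s : Finset {i : S // i ≠ j},
      ∑ i ∈ s, μ (i : S) * q (i : S) j ≤ -(μ j * q j j) := fun s =>
    le_of_tendsto_of_tendsto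
      (tendsto_finsetSum s fun i _ => (hμ i).mul (hconv i j))
      ((hμ j).mul (hconv j j)).neg
      (Eventually.of_forall fun n => (((hp n).2.2.2 j).1.sum_le_tsum s fun i _ =>
        mul_nonneg ((hp n).1 i) ((hqs n).2.1 i j i.2)).trans_eq ((hp n).2.2.2 j).2)
  have hnonneg : ∀ i : {i : S // i ≠ j}, 0 ≤ μ (i : S) * q (i : S) j := fun i =>
    mul_nonneg (hμ0 i) (ge_of_tendsto (hconv i j)
      (Eventually.of_forall fun n => (hqs n).2.1 i j i.2))
  exact ⟨summable_of_sum_le hnonneg hsum, Real.tsum_le_of_sum_le hnonneg hsum⟩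

/-- The convergence part (B.3)-(B.4) of Lemma B.2: along a subsequence on which
`πn (φ n) j₀` converges to `α`, the whole vectors converge pointwise to
`(α / π j₀) • π`, and `α ≤ π j₀`. -/
theorem stmt10 {S : Type*} [Countable S] (q : S → S → ℝ)
    (hq : IsProperQMatrix q) (hirr : IsIrreducibleQ q)
    (π : S → ℝ) (hπ : IsStationaryDistVec q π) (hπpos : ∀ j, 0 < π j)
    (huniq : ∀ μ : S → ℝ, IsSubinvariantMeasure q μ →
      ∃ c : ℝ, 0 < c ∧ ∀ j, μ j = c * π j)
    (qn : ℕ → S → S → ℝ) (hqn : ∀ n, IsProperQMatrix (qn n))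
    (πn : ℕ → S → ℝ) (hπn : ∀ n, IsStationaryDistVec (qn n) (πn n))
    (hconv : ∀ i j, Tendsto (fun n => qn n i j) atTop (nhds (q i j)))
    (j₀ : S) (φ : ℕ → ℕ) (hφ : StrictMono φ) (α : ℝ)
    (hα : Tendsto (fun n => πn (φ n) j₀) atTop (nhds α)) :
    (∀ j, Tendsto (fun n => πn (φ n) j) atTop (nhds (α / π j₀ * π j))) ∧
      α ≤ π j₀ := by
  have key : ∀ U : Ultrafilter ℕ, (U : Filter ℕ) ≤ atTop →
      (∀ j, Tendsto (fun n => πn (φ n) j) U (nhds (α / π j₀ * π j))) ∧ α ≤ π j₀ := by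
    intro U hU
    obtain ⟨μ, hμ, hμ1, hsub⟩ := exists_tendsto_of_isStationaryDistVec U
      (fun n => hqn (φ n)) (fun n => hπn (φ n))
      (fun i j => ((hconv i j).comp hφ.tendsto_atTop).mono_left hU)
    have hμα : μ j₀ = α := tendsto_nhds_unique (hμ j₀) (hα.mono_left hU)
    obtain ⟨c, hc⟩ : ∃ c : ℝ, ∀ j, μ j = c * π j := by
      by_cases h : μ = 0
      · exact ⟨0, by simp [h]⟩
      · obtain ⟨c, -, hc⟩ := huniq μ (hsub h)
        exact ⟨c, hc⟩
    have hαc : α = c * π j₀ := hμα ▸ hc j₀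
    have hcα : c = α / π j₀ := by rw [hαc, mul_div_cancel_right₀ _ (hπpos j₀).ne']
    refine ⟨fun j => by rw [← hcα, ← hc]; exact hμ j, ?_⟩
    have hsum : HasSum μ c := by
      have h : HasSum π 1 := hπ.2.2.1 ▸ hπ.2.1.hasSum
      simpa [funext hc] using h.mul_left c
    have hc1 : c ≤ 1 := hasSum_le_of_sum_le hsum hμ1
    rw [hαc]
    exact mul_le_of_le_one_left (hπpos j₀).le hc1
  exact ⟨fun j => (tendsto_iff_ultrafilter _ _ _).2 fun U hU => (key U hU).1 j,
    (key (Ultrafilter.of atTop) (Ultrafilter.of_le _)).2⟩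
end

section
/- Let S be a countable set and let Q = (q(i,j))_{i,j∈S} be an irreducible proper Q-matrix on S that has a stationary distribution vector π with π(j) > 0 for all j, and assume that every subinvariant measure of Q is a positive scalar multiple of π. For each n ∈ ℕ let Q_n be a proper Q-matrix on S having a stationary distribution vector π_n, and assume lim_{n→∞} q_n(i,j) = q(i,j) for all i, j ∈ S. Fix j₀ ∈ S, a strictly increasing φ : ℕ → ℕ, and α > 0 with lim_{n→∞} π_{φ(n)}(j₀) = α. Then for every finite nonempty A ⊆ S: the sums s_n := Σ_{ℓ∈A} π_{φ(n)}(ℓ) converge to (α/π(j₀))·Σ_{ℓ∈A} π(ℓ) > 0, s_n > 0 for all sufficiently large n, and lim_{n→∞} Σ_{j∈A} | π_{φ(n)}(j)/s_n − π(j)/(Σ_{ℓ∈A} π(ℓ)) | = 0. -/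
open Filter

/-- A pointwise limit of stationary distribution vectors of proper Q-matrices that converge
entrywise is subinvariant for the limit matrix, unless it vanishes identically. -/
theorem isSubinvariantMeasure_of_tendsto {S ι : Type*} {l : Filter ι} [l.NeBot]
    {q : S → S → ℝ} {μ : S → ℝ} {p : ι → S → S → ℝ} {ν : ι → S → ℝ}
    (hp : ∀ n, IsProperQMatrix (p n)) (hν : ∀ n, IsStationaryDistVec (p n) (ν n))
    (hpq : ∀ i j, Tendsto (fun n => p n i j) l (nhds (q i j)))
    (hνμ : ∀ j, Tendsto (fun n => ν n j) l (nhds (μ j))) (hμ : μ ≠ 0) :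
    IsSubinvariantMeasure q μ := by
  have hμ_nonneg : ∀ i, 0 ≤ μ i := fun i => ge_of_tendsto' (hνμ i) fun n => (hν n).1 i
  have hq_nonneg : ∀ i j, i ≠ j → 0 ≤ q i j := fun i j hij =>
    ge_of_tendsto' (hpq i j) fun n => (hp n).2.1 i j hij
  refine ⟨hμ_nonneg, hμ, fun j => ?_⟩
  have hsum_le : ∀ F : Finset {i : S // i ≠ j},
      ∑ i ∈ F, μ (i : S) * q (i : S) j ≤ -(μ j * q j j) := fun F =>
    le_of_tendsto_of_tendsto'
      (tendsto_finsetSum F fun i _ => (hνμ (i : S)).mul (hpq (i : S) j))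
      ((hνμ j).mul (hpq j j)).neg fun n =>
        (((hν n).2.2.2 j).1.sum_le_tsum F fun i _ =>
          mul_nonneg ((hν n).1 i) ((hp n).2.1 i j i.2)).trans ((hν n).2.2.2 j).2.le
  have hsum : Summable fun i : {i : S // i ≠ j} => μ (i : S) * q (i : S) j :=
    summable_of_sum_le (fun i => mul_nonneg (hμ_nonneg i) (hq_nonneg i j i.2)) hsum_le
  exact ⟨hsum, hsum.tsum_le_of_sum_le hsum_le⟩

theorem IsStationaryDistVec.le_one {S : Type*} {q : S → S → ℝ} {π : S → ℝ}
    (h : IsStationaryDistVec q π) (j : S) : π j ≤ 1 :=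
  (h.2.1.le_tsum j fun i _ => h.1 i).trans h.2.2.1.le

/-- The conditional-distribution convergence (B.5) of Lemma B.2: along a subsequence
on which `πn (φ n) j₀` converges to `α > 0`, the conditional distributions on any
finite nonempty set `A` converge in total variation to the conditional distribution
of `π` on `A`. -/
theorem stmt11 {S : Type*} [Countable S] (q : S → S → ℝ)
    (hq : IsProperQMatrix q) (hirr : IsIrreducibleQ q)
    (π : S → ℝ) (hπ : IsStationaryDistVec q π) (hπpos : ∀ j, 0 < π j)
    (huniq : ∀ μ : S → ℝ, IsSubinvariantMeasure q μ →
      ∃ c : ℝ, 0 < c ∧ ∀ j, μ j = c * π j)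
    (qn : ℕ → S → S → ℝ) (hqn : ∀ n, IsProperQMatrix (qn n))
    (πn : ℕ → S → ℝ) (hπn : ∀ n, IsStationaryDistVec (qn n) (πn n))
    (hconv : ∀ i j, Tendsto (fun n => qn n i j) atTop (nhds (q i j)))
    (j₀ : S) (φ : ℕ → ℕ) (hφ : StrictMono φ) (α : ℝ) (hα0 : 0 < α)
    (hα : Tendsto (fun n => πn (φ n) j₀) atTop (nhds α)) :
    ∀ A : Finset S, A.Nonempty →
      Tendsto (fun n => ∑ ℓ ∈ A, πn (φ n) ℓ) atTop
        (nhds (α / π j₀ * ∑ ℓ ∈ A, π ℓ)) ∧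
      0 < α / π j₀ * ∑ ℓ ∈ A, π ℓ ∧
      (∀ᶠ n in atTop, 0 < ∑ ℓ ∈ A, πn (φ n) ℓ) ∧
      Tendsto
        (fun n => ∑ j ∈ A,
          |πn (φ n) j / (∑ ℓ ∈ A, πn (φ n) ℓ) - π j / (∑ ℓ ∈ A, π ℓ)|)
        atTop (nhds 0) := by
  have hlim : Tendsto (fun n => πn (φ n)) atTop (nhds fun j => α / π j₀ * π j) := by
    refine (isCompact_univ_pi fun _ : S => isCompact_Icc
      (a := (0 : ℝ)) (b := 1)).tendsto_nhds_of_unique_mapClusterPt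
      (Eventually.of_forall fun n j _ => ⟨(hπn _).1 j, (hπn _).le_one j⟩) fun μ _ hμ => ?_
    obtain ⟨U, hU, hUμ⟩ := mapClusterPt_iff_ultrafilter.1 hμ
    rw [tendsto_pi_nhds] at hUμ
    have hμj₀ : μ j₀ = α := tendsto_nhds_unique (hUμ j₀) (hα.mono_left hU)
    have hμ_ne : μ ≠ 0 := fun h => hα0.ne' (by rw [← hμj₀, h, Pi.zero_apply])
    obtain ⟨c, -, hc⟩ := huniq μ <| isSubinvariantMeasure_of_tendsto
      (fun n => hqn (φ n)) (fun n => hπn (φ n))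
      (fun i j => ((hconv i j).comp hφ.tendsto_atTop).mono_left hU) hUμ hμ_ne
    have hcα : c = α / π j₀ := by
      rw [eq_div_iff (hπpos j₀).ne', ← hc, hμj₀]
    funext j
    rw [hc, hcα]
  rw [tendsto_pi_nhds] at hlim
  intro A hA
  have hA_pos : 0 < ∑ ℓ ∈ A, π ℓ := Finset.sum_pos (fun j _ => hπpos j) hA
  have hc_pos : 0 < α / π j₀ := div_pos hα0 (hπpos j₀)
  have hs : Tendsto (fun n => ∑ ℓ ∈ A, πn (φ n) ℓ) atTop
      (nhds (α / π j₀ * ∑ ℓ ∈ A, π ℓ)) := by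
    rw [Finset.mul_sum]
    exact tendsto_finsetSum A fun j _ => hlim j
  have hs_pos := mul_pos hc_pos hA_pos
  refine ⟨hs, hs_pos, hs.eventually_const_lt hs_pos, ?_⟩
  rw [← Finset.sum_const_zero (s := A)]
  refine tendsto_finsetSum A fun j _ => ?_
  have hdiv := ((hlim j).div hs hs_pos.ne').sub_const (π j / ∑ ℓ ∈ A, π ℓ)
  rw [mul_div_mul_left _ _ hc_pos.ne', sub_self] at hdiv
  simpa using hdiv.abs
end
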